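/- Let p ≥ 2 and 1 ≤ s ≤ p−1 be integers, τ ∈ ℍ, q = e^{2πiτ}, x = e^{2πiu}, and suppose x q^{p(n+1/2)±s/2} ≠ 1 for all n ∈ ℤ. Then the meromorphically continued character of the B_p-module W_s is the specialization v = sτ/2 of the Appell–Lerch continuation of ch[X_p]: explicitly, e^{−2πiu} AL_2(u + pτ/2, sτ/2; pτ) = q^{p/4 − s²/(4p)} ∑_{n∈ℤ} ( q^{p(n+1/2+s/(2p))²}/(1 − x q^{p(n+1/2+s/(2p))}) − q^{p(n+1/2−s/(2p))²}/(1 − x q^{p(n+1/2−s/(2p))}) ), where the series on the right equals −η(τ)² ch[W_s](u;τ). -/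

import Mathlib

open Complex

/-- `e z = exp(2πi z)`. -/
noncomputable def e (z : ℂ) : ℂ := Complex.exp (2 * Real.pi * Complex.I * z)

/-- The level-two Appell–Lerch sum. -/
noncomputable def A2 (s t τ : ℂ) : ℂ :=
  e s * ∑' n : ℤ, e ((n * (n + 1)) * τ + n * t) / (1 - e (s + n * τ))

/-- `AL₂(s,t;τ) = A₂(s+t, 2t; τ) − A₂(s−t, −2t; τ)`. -/
noncomputable def AL2 (s t τ : ℂ) : ℂ := A2 (s + t) (2 * t) τ - A2 (s - t) (-2 * t) τ

/-- Dedekind eta `η(τ) = q^{1/24} ∏_{n≥1} (1 − qⁿ)`, `q = e(τ)`. -/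
noncomputable def etaE (τ : ℂ) : ℂ := e (τ / 24) * ∏' n : ℕ, (1 - e ((n + 1) * τ))

/-- The closed-form character of the `B_p`-module `W_s`:
`ch[W_s](u;τ) = η(τ)⁻² ∑_{n∈ℤ} ( q^{p(n+1/2−s/(2p))²}/(1 − x q^{p(n+1/2−s/(2p))}) −
q^{p(n+1/2+s/(2p))²}/(1 − x q^{p(n+1/2+s/(2p))}) )`, `x = e(u)`, `q^α = e(ατ)`. -/
noncomputable def chW (p s : ℕ) (u τ : ℂ) : ℂ :=
  ((etaE τ) ^ 2)⁻¹ * ∑' n : ℤ,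
    (e (((p : ℂ) * ((n : ℂ) + 1/2 - (s : ℂ) / (2 * p)) ^ 2) * τ) /
        (1 - e u * e (((p : ℂ) * ((n : ℂ) + 1/2 - (s : ℂ) / (2 * p))) * τ)) -
      e (((p : ℂ) * ((n : ℂ) + 1/2 + (s : ℂ) / (2 * p)) ^ 2) * τ) /
        (1 - e u * e (((p : ℂ) * ((n : ℂ) + 1/2 + (s : ℂ) / (2 * p))) * τ)))

lemma e_add (a b : ℂ) : e (a + b) = e a * e b := by
  simp only [e, mul_add, Complex.exp_add]

lemma norm_e (z : ℂ) : ‖e z‖ = Real.exp (-(2 * Real.pi * z.im)) := by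
  simp [e, Complex.norm_exp]

lemma eventually_half_le_norm_one_sub_e (s τ : ℂ) (hτ : 0 < τ.im) :
    ∀ᶠ n : ℤ in Filter.cofinite, 1 / 2 ≤ ‖1 - e (s + n * τ)‖ := by
  have hn (n : ℤ) : ‖e (s + n * τ)‖ =
      Real.exp (-(2 * Real.pi * s.im) + (n : ℝ) * -(2 * Real.pi * τ.im)) := by
    rw [norm_e]
    congr 1
    simp
    ring
  have hneg : -(2 * Real.pi * τ.im) < 0 := by
    have := Real.pi_pos
    simp only [neg_lt_zero]
    positivity
  rw [Int.cofinite_eq, Filter.eventually_sup]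
  constructor
  · have h : Filter.Tendsto (fun n : ℤ => ‖e (s + n * τ)‖) Filter.atBot Filter.atTop := by
      simp_rw [hn]
      exact Real.tendsto_exp_atTop.comp (Filter.tendsto_atTop_add_const_left _ _
        ((tendsto_intCast_atBot_iff.2 Filter.tendsto_id).atBot_mul_const_of_neg hneg))
    filter_upwards [h.eventually_ge_atTop 2] with n h2
    have := norm_sub_norm_le (e (s + n * τ)) 1
    rw [norm_sub_rev, norm_one] at this
    linarith
  · have h : Filter.Tendsto (fun n : ℤ => ‖e (s + n * τ)‖) Filter.atTop (nhds 0) := by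
      simp_rw [hn]
      exact Real.tendsto_exp_atBot.comp (Filter.tendsto_atBot_add_const_left _ _
        ((tendsto_intCast_atTop_atTop (R := ℝ)).atTop_mul_const_of_neg hneg))
    filter_upwards [h.eventually_le_const (show (0 : ℝ) < 1 / 2 by norm_num)] with n h2
    have := norm_sub_norm_le 1 (e (s + n * τ))
    rw [norm_one] at this
    linarith

lemma summable_A2_term (s t τ : ℂ) (hτ : 0 < τ.im) :
    Summable fun n : ℤ => e ((n * (n + 1)) * τ + n * t) / (1 - e (s + n * τ)) := by
  have h : Summable fun n : ℤ => e ((n * (n + 1)) * τ + n * t) := by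
    refine ((summable_jacobiTheta₂_term_iff (t + τ) (2 * τ)).2 (by simpa using hτ)).congr
      fun n => ?_
    simp only [jacobiTheta₂_term, e]
    congr 1
    ring
  refine (h.norm.mul_left 2).of_norm_bounded_eventually ?_
  filter_upwards [eventually_half_le_norm_one_sub_e s τ hτ] with n hn
  rw [norm_div, div_le_iff₀ (by linarith)]
  nlinarith [norm_nonneg (e ((n * (n + 1)) * τ + n * t))]

lemma etaE_ne_zero {τ : ℂ} (hτ : 0 < τ.im) : etaE τ ≠ 0 := by
  refine mul_ne_zero (Complex.exp_ne_zero _) ?_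
  convert ModularForm.eta_tprod_ne_zero (z := τ) hτ using 4 with n
  rw [ModularForm.eta_q_eq_cexp, e]
  congr 1
  ring

/-- For `σ = ±s`, the Appell–Lerch sum in `AL2` at `(u + pτ/2, sτ/2; pτ)`, termwise in the shape
of the character of `W_s`. -/
lemma hasSum_A2_specialization {p : ℂ} (hp : p ≠ 0) (σ τ u : ℂ) (hτ : 0 < (p * τ).im) :
    HasSum (fun n : ℤ => e ((p / 4 - σ ^ 2 / (4 * p)) * τ) *
      (e ((p * ((n : ℂ) + 1/2 + σ / (2 * p)) ^ 2) * τ) /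
        (1 - e u * e ((p * ((n : ℂ) + 1/2 + σ / (2 * p))) * τ))))
      (e (-u) * A2 (u + p * τ / 2 + σ * τ / 2) (σ * τ) (p * τ)) := by
  rw [A2, ← mul_assoc, ← e_add]
  refine ((summable_A2_term (u + p * τ / 2 + σ * τ / 2) (σ * τ) (p * τ) hτ).hasSum.mul_left
    _).congr_fun fun n => ?_
  rw [← mul_div_assoc, ← mul_div_assoc, ← e_add, ← e_add, ← e_add]
  congr 2
  · field_simp
    ring
  · congr 1
    field_simp
    ring

/-- The meromorphically continued character of the `B_p`-module `W_s` is the specialization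
`v = sτ/2` of the Appell–Lerch continuation of `ch[X_p]`: explicitly,
`e(−u) AL₂(u + pτ/2, sτ/2; pτ) = q^{p/4 − s²/(4p)} ∑_{n∈ℤ} ( q^{p(n+1/2+s/(2p))²}/(1−xq^{...}) −
q^{p(n+1/2−s/(2p))²}/(1−xq^{...}) )`, and the series on the right equals `−η(τ)² ch[W_s](u;τ)`. -/
theorem chWs_specialization (p s : ℕ) (hp : 2 ≤ p) (hs1 : 1 ≤ s) (hs2 : s ≤ p - 1)
    (τ u : ℂ) (hτ : 0 < τ.im)
    (hreg : ∀ n : ℤ,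
      e (u + ((p : ℂ) * ((n : ℂ) + 1/2) + (s : ℂ) / 2) * τ) ≠ 1 ∧
      e (u + ((p : ℂ) * ((n : ℂ) + 1/2) - (s : ℂ) / 2) * τ) ≠ 1) :
    e (-u) * AL2 (u + (p : ℂ) * τ / 2) ((s : ℂ) * τ / 2) ((p : ℂ) * τ) =
      e (((p : ℂ) / 4 - (s : ℂ) ^ 2 / (4 * p)) * τ) *
        ∑' n : ℤ,
          (e (((p : ℂ) * ((n : ℂ) + 1/2 + (s : ℂ) / (2 * p)) ^ 2) * τ) /
              (1 - e u * e (((p : ℂ) * ((n : ℂ) + 1/2 + (s : ℂ) / (2 * p))) * τ)) -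
            e (((p : ℂ) * ((n : ℂ) + 1/2 - (s : ℂ) / (2 * p)) ^ 2) * τ) /
              (1 - e u * e (((p : ℂ) * ((n : ℂ) + 1/2 - (s : ℂ) / (2 * p))) * τ))) ∧
    (∑' n : ℤ,
      (e (((p : ℂ) * ((n : ℂ) + 1/2 + (s : ℂ) / (2 * p)) ^ 2) * τ) /
          (1 - e u * e (((p : ℂ) * ((n : ℂ) + 1/2 + (s : ℂ) / (2 * p))) * τ)) -
        e (((p : ℂ) * ((n : ℂ) + 1/2 - (s : ℂ) / (2 * p)) ^ 2) * τ) /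
          (1 - e u * e (((p : ℂ) * ((n : ℂ) + 1/2 - (s : ℂ) / (2 * p))) * τ)))) =
      -((etaE τ) ^ 2) * chW p s u τ := by
  have hp0 : (p : ℂ) ≠ 0 := Nat.cast_ne_zero.2 (by omega)
  have hpτ : 0 < ((p : ℂ) * τ).im := by
    rw [← Complex.ofReal_natCast, Complex.im_ofReal_mul]
    have : (0 : ℝ) < p := Nat.cast_pos.2 (by omega)
    positivity
  constructor
  · have h := (hasSum_A2_specialization hp0 s τ u hpτ).sub
      (hasSum_A2_specialization hp0 (-s) τ u hpτ)
    simp only [neg_sq, neg_div, ← sub_eq_add_neg, ← mul_sub] at h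
    rw [← tsum_mul_left, h.tsum_eq, AL2]
    congr 3 <;> ring_nf
  · rw [chW, neg_mul, mul_inv_cancel_left₀ (pow_ne_zero 2 (etaE_ne_zero hτ)), ← tsum_neg]
    simp only [neg_sub]
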